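/- Let X be a compact metric space, f : X → X continuous, and φ : X → ℝ continuous. If ∫ φ dμ > λ for every f-invariant Borel probability measure μ, then for every x ∈ X there exists a positive integer n(x) such that (1/n(x)) · Σ_{i=0}^{n(x)-1} φ(f^i(x)) > λ. -/

import Mathlib

open MeasureTheory

open Filter Topology BoundedContinuousFunction

section EmpiricalMeasure

variable {X : Type*} [MeasurableSpace X]

/-- The uniform measure on the first `n + 1` points of the orbit of `x` under `f`. -/
noncomputable def empiricalMeasure (f : X → X) (x : X) (n : ℕ) : Measure X :=
  ((n + 1 : ℕ) : ENNReal)⁻¹ • ∑ i ∈ Finset.range (n + 1), Measure.dirac (f^[i] x)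

instance isProbabilityMeasure_empiricalMeasure (f : X → X) (x : X) (n : ℕ) :
    IsProbabilityMeasure (empiricalMeasure f x n) := by
  refine ⟨?_⟩
  simp only [empiricalMeasure, Measure.smul_apply, Measure.finsetSum_apply, measure_univ,
    Finset.sum_const, Finset.card_range, smul_eq_mul, nsmul_eq_mul, mul_one]
  exact ENNReal.inv_mul_cancel (by simp) (ENNReal.natCast_ne_top _)

theorem integral_empiricalMeasure (f : X → X) (x : X) (n : ℕ) {g : X → ℝ}
    (hg : StronglyMeasurable g) :
    ∫ y, g y ∂empiricalMeasure f x n = birkhoffAverage ℝ f g (n + 1) x := by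
  rw [empiricalMeasure, integral_smul_measure, integral_finsetSum_measure]
  · simp only [integral_dirac' _ _ hg, ENNReal.toReal_inv, ENNReal.toReal_natCast]
    rfl
  · intro i _
    exact integrable_dirac' hg (by simp)

end EmpiricalMeasure

/-- **Krylov–Bogolyubov**: along some ultrafilter, the Birkhoff averages at `x` of all continuous
functions converge to their integrals against an invariant probability measure. -/
theorem exists_invariant_tendsto_birkhoffAverage {X : Type*} [MetricSpace X] [CompactSpace X]
    [MeasurableSpace X] [BorelSpace X] {f : X → X} (hf : Continuous f) (x : X) :
    ∃ (μ : ProbabilityMeasure X) (U : Ultrafilter ℕ), Measure.map f μ = μ ∧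
      ∀ g : X →ᵇ ℝ, Tendsto (fun n ↦ birkhoffAverage ℝ f g (n + 1) x) U (𝓝 (∫ y, g y ∂μ)) := by
  let ν : ℕ → ProbabilityMeasure X := fun n ↦ ⟨empiricalMeasure f x n, inferInstance⟩
  let U : Ultrafilter ℕ := hyperfilter ℕ
  have hU : (U : Filter ℕ) ≤ atTop := Nat.hyperfilter_le_atTop
  obtain ⟨μ, -, hμ⟩ := isCompact_univ.ultrafilter_le_nhds (U.map ν) (by simp)
  have hlim (g : X →ᵇ ℝ) :
      Tendsto (fun n ↦ birkhoffAverage ℝ f g (n + 1) x) U (𝓝 (∫ y, g y ∂μ)) := by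
    refine (ProbabilityMeasure.tendsto_iff_forall_integral_tendsto.1 hμ g).congr fun n ↦ ?_
    exact integral_empiricalMeasure f x n g.continuous.stronglyMeasurable
  refine ⟨μ, U, ?_, hlim⟩
  have : IsProbabilityMeasure (Measure.map f (μ : Measure X)) :=
    Measure.isProbabilityMeasure_map hf.aemeasurable
  refine ext_of_forall_integral_eq_of_IsFiniteMeasure fun g ↦ ?_
  rw [integral_map hf.aemeasurable g.continuous.aestronglyMeasurable]
  have hdiff := (tendsto_birkhoffAverage_apply_sub_birkhoffAverage' ℝ g.isBounded_range f x).comp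
    (tendsto_add_atTop_nat 1)
  have hsub := (hlim (g.compContinuous ⟨f, hf⟩)).sub (hlim g)
  refine sub_eq_zero.1 (tendsto_nhds_unique hsub ((hdiff.mono_left hU).congr fun n ↦ ?_))
  simp only [Function.comp_apply, birkhoffAverage, birkhoffSum, compContinuous_apply,
    ContinuousMap.coe_mk, ← Function.iterate_succ_apply, Function.iterate_succ_apply']

/-- If the integral of a continuous function `φ` is `> λ` for every `f`-invariant
Borel probability measure on a compact metric space, then for every point `x`
there is a positive integer `n` whose Birkhoff average at `x` is `> λ`. -/
theorem stmt_2 {X : Type*} [MetricSpace X] [CompactSpace X]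
    [MeasurableSpace X] [BorelSpace X]
    (f : X → X) (hf : Continuous f) (φ : X → ℝ) (hφ : Continuous φ) (lam : ℝ)
    (h : ∀ μ : Measure X, IsProbabilityMeasure μ → Measure.map f μ = μ →
      ∫ x, φ x ∂μ > lam) :
    ∀ x : X, ∃ n : ℕ, 0 < n ∧
      (1 / (n : ℝ)) * ∑ i ∈ Finset.range n, φ (f^[i] x) > lam := by
  intro x
  obtain ⟨μ, U, hμ, hlim⟩ := exists_invariant_tendsto_birkhoffAverage hf x
  have hlam := h μ inferInstance hμ
  obtain ⟨n, hn⟩ := ((hlim (mkOfCompact ⟨φ, hφ⟩)).eventually_const_lt hlam).exists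
  refine ⟨n + 1, n.succ_pos, ?_⟩
  rw [one_div]
  exact hn
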